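/- Let F be a skew-symmetric endomorphism of Minkowski space 𝕄^{1,d-1} and let m₀ be the multiplicity of 0 as a root of the characteristic polynomial of F. Then exactly one of the following two cases holds: (a) the restriction of η to ker F is nondegenerate (this includes ker F = {0}), which happens if and only if rank F = d - m₀; (b) the restriction of η to ker F is degenerate (there exists a nonzero w ∈ ker F with η(w,u) = 0 for all u ∈ ker F), which happens if and only if m₀ > 2 and rank F = d - m₀ + 2. -/

import Mathlib

open scoped BigOperators

/-- The Minkowski bilinear form on `ℝ^d`. -/
noncomputable def mink (d : ℕ) (x y : Fin d → ℝ) : ℝ :=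
  ∑ i : Fin d, (if (i : ℕ) = 0 then (-1 : ℝ) else 1) * x i * y i

/-- Skew-symmetry w.r.t. the Minkowski form. -/
def IsSkew (d : ℕ) (F : (Fin d → ℝ) →ₗ[ℝ] (Fin d → ℝ)) : Prop :=
  ∀ x y, mink d (F x) y = - mink d x (F y)

open LinearMap Module

/-- The Minkowski form as a bilinear form. -/
noncomputable def minkBilin (d : ℕ) : LinearMap.BilinForm ℝ (Fin d → ℝ) :=
  LinearMap.mk₂ ℝ (mink d)
    (fun x x' y => by
      simp only [mink, Pi.add_apply, ← Finset.sum_add_distrib]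
      exact Finset.sum_congr rfl fun i _ => by ring)
    (fun c x y => by
      simp only [mink, Pi.smul_apply, smul_eq_mul, Finset.mul_sum]
      exact Finset.sum_congr rfl fun i _ => by ring)
    (fun x y y' => by
      simp only [mink, Pi.add_apply, ← Finset.sum_add_distrib]
      exact Finset.sum_congr rfl fun i _ => by ring)
    (fun c x y => by
      simp only [mink, Pi.smul_apply, smul_eq_mul, Finset.mul_sum]
      exact Finset.sum_congr rfl fun i _ => by ring)

theorem minkBilin_apply (d : ℕ) (x y : Fin d → ℝ) : minkBilin d x y = mink d x y := rfl

theorem mink_comm (d : ℕ) (x y : Fin d → ℝ) : mink d x y = mink d y x :=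
  Finset.sum_congr rfl fun i _ => by ring

theorem eq_zero_of_forall_mink_eq_zero {d : ℕ} {x : Fin d → ℝ} (h : ∀ y, mink d x y = 0) :
    x = 0 := by
  ext i
  have hi := h (Pi.single i 1)
  simp only [mink, Pi.single_apply, mul_ite, mul_one, mul_zero, Finset.sum_ite_eq',
    Finset.mem_univ, if_true] at hi
  split_ifs at hi <;> simpa using hi

theorem minkBilin_nondegenerate (d : ℕ) : (minkBilin d).Nondegenerate :=
  ⟨fun _ h => eq_zero_of_forall_mink_eq_zero h,
    fun y h => eq_zero_of_forall_mink_eq_zero fun x => (mink_comm d y x).trans (h x)⟩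

/-- A null vector without time component vanishes. -/
theorem eq_zero_of_mink_self_eq_zero {d : ℕ} {z : Fin d → ℝ} (hz : mink d z z = 0)
    (h0 : ∀ i : Fin d, (i : ℕ) = 0 → z i = 0) : z = 0 := by
  have hsum : ∑ i, z i * z i = 0 := by
    rw [← hz]
    refine Finset.sum_congr rfl fun i _ => ?_
    split_ifs with hi
    · simp [h0 i hi]
    · ring
  rw [Finset.sum_eq_zero_iff_of_nonneg fun i _ => mul_self_nonneg _] at hsum
  ext i
  exact mul_self_eq_zero.mp (hsum i (Finset.mem_univ i))

/-- Two orthogonal null vectors in Minkowski space are proportional. -/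
theorem mem_span_singleton_of_null {d : ℕ} {a b : Fin d → ℝ} (ha : a ≠ 0)
    (haa : mink d a a = 0) (hbb : mink d b b = 0) (hab : mink d a b = 0) :
    b ∈ Submodule.span ℝ {a} := by
  obtain ⟨j, hj, haj⟩ : ∃ i : Fin d, (i : ℕ) = 0 ∧ a i ≠ 0 := by
    by_contra! h
    exact ha (eq_zero_of_mink_self_eq_zero haa h)
  rw [Submodule.mem_span_singleton]
  refine ⟨b j / a j, ?_⟩
  have hz : b - (b j / a j) • a = 0 := by
    apply eq_zero_of_mink_self_eq_zero
    · have hba := mink_comm d b a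
      simp only [← minkBilin_apply] at *
      simp [haa, hbb, hab, hba]
    · intro i hi
      obtain rfl : i = j := Fin.ext (hi.trans hj.symm)
      simp [haj]
  exact (sub_eq_zero.mp hz).symm

/-- Each step in the filtration by kernels of powers adds the dimension of
`ker f ∩ range (f ^ k)`. -/
theorem finrank_ker_pow_succ {K V : Type*} [Field K] [AddCommGroup V] [Module K V]
    [FiniteDimensional K V] (f : Module.End K V) (k : ℕ) :
    finrank K (ker (f ^ (k + 1))) =
      finrank K (ker (f ^ k)) + finrank K (ker f ⊓ range (f ^ k) : Submodule K V) := by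
  have h := finrank_range_add_finrank_ker ((f ^ k).domRestrict (ker (f ^ (k + 1))))
  have hle : ker (f ^ k) ≤ ker (f ^ (k + 1)) := fun x hx => by
    rw [mem_ker] at hx ⊢
    rw [pow_succ', Module.End.mul_apply, hx, map_zero]
  have hr : range ((f ^ k).domRestrict (ker (f ^ (k + 1)))) = ker f ⊓ range (f ^ k) := by
    ext y
    simp only [mem_range, Submodule.mem_inf, mem_ker, Subtype.exists, domRestrict_apply]
    constructor
    · rintro ⟨x, hx, rfl⟩
      exact ⟨by rwa [pow_succ'] at hx, x, rfl⟩
    · rintro ⟨hy, x, rfl⟩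
      exact ⟨x, by rwa [pow_succ'], rfl⟩
  have hk : finrank K (ker ((f ^ k).domRestrict (ker (f ^ (k + 1))))) =
      finrank K (ker (f ^ k)) := by
    rw [LinearMap.ker_domRestrict]
    exact (Submodule.comapSubtypeEquivOfLe hle).finrank_eq
  rw [hr, hk] at h
  lia

/-- Once the kernels of powers stabilise, their dimension is the algebraic multiplicity of `0`. -/
theorem rootMultiplicity_zero_eq_finrank_ker_pow {K V : Type*} [Field K] [AddCommGroup V]
    [Module K V] [FiniteDimensional K V] (f : Module.End K V) {k : ℕ}
    (h : (ker f ⊓ range (f ^ k) : Submodule K V) = ⊥) :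
    f.charpoly.rootMultiplicity 0 = finrank K (ker (f ^ k)) := by
  have hle : ker (f ^ k) ≤ ker (f ^ (k + 1)) := fun x hx => by
    rw [mem_ker] at hx ⊢
    rw [pow_succ', Module.End.mul_apply, hx, map_zero]
  have hst : ker (f ^ k) = ker (f ^ k.succ) :=
    Submodule.eq_of_le_of_finrank_eq hle (by rw [finrank_ker_pow_succ, h, finrank_bot, add_zero])
  have hmax : f.maxGenEigenspace 0 = ker (f ^ k) := by
    ext x
    rw [Module.End.mem_maxGenEigenspace]
    simp only [zero_smul, sub_zero]
    constructor
    · rintro ⟨n, hn⟩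
      rw [Module.End.ker_pow_constant hst n, mem_ker, pow_add, Module.End.mul_apply, hn, map_zero]
    · exact fun hx => ⟨k, hx⟩
  rw [← finrank_maxGenEigenspace_eq, hmax]

theorem IsSkew.mink_pow {d : ℕ} {F : Module.End ℝ (Fin d → ℝ)} (hF : IsSkew d F) (k : ℕ)
    (x y : Fin d → ℝ) : mink d ((F ^ k) x) y = (-1) ^ k * mink d x ((F ^ k) y) := by
  induction k generalizing y with
  | zero => simp
  | succ k ih =>
    rw [pow_succ' F, Module.End.mul_apply, hF, ih, ← Module.End.mul_apply, ← pow_succ,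
      ← pow_succ']
    ring

/-- The range of a power of a skew endomorphism is the orthogonal complement of its kernel. -/
theorem IsSkew.mem_range_pow {d : ℕ} {F : Module.End ℝ (Fin d → ℝ)} (hF : IsSkew d F) (k : ℕ)
    (x : Fin d → ℝ) : x ∈ range (F ^ k) ↔ ∀ y ∈ ker (F ^ k), mink d x y = 0 := by
  have hle : range (F ^ k) ≤ (minkBilin d).orthogonal (ker (F ^ k)) := by
    rintro _ ⟨x, rfl⟩ y hy
    change mink d _ _ = 0
    rw [mink_comm, hF.mink_pow, mem_ker.mp hy, ← minkBilin_apply, map_zero, mul_zero]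
  have heq := Submodule.eq_of_le_of_finrank_eq hle (by
    rw [LinearMap.BilinForm.finrank_orthogonal (minkBilin_nondegenerate d),
      ← finrank_range_add_finrank_ker (F ^ k), Nat.add_sub_cancel])
  rw [heq, LinearMap.BilinForm.mem_orthogonal_iff]
  exact forall₂_congr fun y _ => by
    rw [mink_comm]
    rfl

theorem IsSkew.mem_range {d : ℕ} {F : Module.End ℝ (Fin d → ℝ)} (hF : IsSkew d F)
    (x : Fin d → ℝ) : x ∈ range F ↔ ∀ y ∈ ker F, mink d x y = 0 := by
  simpa using hF.mem_range_pow 1 x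

/-- If the Minkowski form is degenerate on the kernel of a skew endomorphism, then `0` has
algebraic multiplicity two more than the dimension of the kernel. -/
theorem IsSkew.rootMultiplicity_of_degenerate {d : ℕ} {F : Module.End ℝ (Fin d → ℝ)}
    (hF : IsSkew d F) {w : Fin d → ℝ} (hw : w ∈ ker F) (hw0 : w ≠ 0)
    (hwo : ∀ u ∈ ker F, mink d w u = 0) :
    F.charpoly.rootMultiplicity 0 = finrank ℝ (ker F) + 2 := by
  have hwr : w ∈ range F := (hF.mem_range w).mpr hwo
  have hspan : (ker F ⊓ range F : Submodule ℝ (Fin d → ℝ)) ≤ Submodule.span ℝ {w} := by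
    rintro x ⟨hxk, hxr⟩
    exact mem_span_singleton_of_null hw0 (hwo w hw) ((hF.mem_range x).mp hxr x hxk) (hwo x hxk)
  have hrange (k : ℕ) : range (F ^ (k + 1)) ≤ range F := by
    rw [pow_succ']
    exact range_comp_le_range _ _
  have hone (k : ℕ) (h : w ∈ range (F ^ (k + 1))) :
      finrank ℝ (ker F ⊓ range (F ^ (k + 1)) : Submodule ℝ (Fin d → ℝ)) = 1 := by
    have heq : (ker F ⊓ range (F ^ (k + 1)) : Submodule ℝ (Fin d → ℝ)) =
        Submodule.span ℝ {w} := by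
      refine le_antisymm ((inf_le_inf_left _ (hrange k)).trans hspan) ?_
      rw [Submodule.span_singleton_le_iff_mem]
      exact ⟨hw, h⟩
    rw [heq, finrank_span_singleton hw0]
  have hw2 : w ∈ range (F ^ 2) := by
    obtain ⟨v, rfl⟩ := hwr
    rw [hF.mem_range_pow]
    intro y hy
    have hFy : F y ∈ Submodule.span ℝ {F v} :=
      hspan ⟨by rwa [pow_two] at hy, y, rfl⟩
    obtain ⟨c, hc⟩ := Submodule.mem_span_singleton.mp hFy
    have hvv := hF v v
    rw [mink_comm d v] at hvv
    rw [hF, ← hc, ← minkBilin_apply, map_smul, minkBilin_apply, mink_comm,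
      show mink d (F v) v = 0 by linarith]
    simp
  have hw3 : w ∉ range (F ^ 3) := by
    intro h3
    obtain ⟨u, hu⟩ := hw2
    have hFF : F (F u) = w := by rw [← hu, pow_two, Module.End.mul_apply]
    have hu0 : mink d w u = 0 := (hF.mem_range_pow 3 _).mp h3 u (by
      rw [mem_ker, pow_succ', Module.End.mul_apply, hu]
      exact hw)
    have hn : mink d (F u) (F u) = 0 := by
      rw [← hFF, hF] at hu0
      linarith
    have ho : mink d w (F u) = 0 := by
      have h := hF (F u) (F u)
      rw [mink_comm d (F u), hFF] at h
      linarith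
    obtain ⟨c, hc⟩ := Submodule.mem_span_singleton.mp
      (mem_span_singleton_of_null hw0 (hwo w hw) hn ho)
    apply hw0
    rw [← hFF, ← hc, map_smul, mem_ker.mp hw, smul_zero]
  have hbot : (ker F ⊓ range (F ^ 3) : Submodule ℝ (Fin d → ℝ)) = ⊥ := by
    rw [eq_bot_iff]
    rintro x ⟨hxk, hxr⟩
    obtain ⟨c, rfl⟩ := Submodule.mem_span_singleton.mp (hspan ⟨hxk, hrange 2 hxr⟩)
    by_cases hc : c = 0
    · simp [hc]
    · exact absurd ((Submodule.smul_mem_iff _ hc).mp hxr) hw3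
  rw [rootMultiplicity_zero_eq_finrank_ker_pow F hbot, finrank_ker_pow_succ F 2,
    finrank_ker_pow_succ F 1, hone 1 hw2, hone 0 (by simpa using hwr), pow_one]

/-- If the Minkowski form is nondegenerate on the kernel of a skew endomorphism, then the
algebraic and geometric multiplicities of `0` agree. -/
theorem IsSkew.rootMultiplicity_of_nondegenerate {d : ℕ} {F : Module.End ℝ (Fin d → ℝ)}
    (hF : IsSkew d F)
    (h : ∀ x ∈ ker F, (∀ y ∈ ker F, mink d x y = 0) → x = 0) :
    F.charpoly.rootMultiplicity 0 = finrank ℝ (ker F) := by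
  rw [rootMultiplicity_zero_eq_finrank_ker_pow F (k := 1), pow_one]
  rw [eq_bot_iff, pow_one]
  exact fun x hx => h x hx.1 ((hF.mem_range x).mp hx.2)

/-- With `m₀` the multiplicity of `0` in the characteristic polynomial of a
skew-symmetric endomorphism `F`: the Minkowski form is nondegenerate on
`ker F` iff `rank F = d - m₀`, and degenerate on `ker F` iff `m₀ > 2` and
`rank F = d - m₀ + 2`. -/
theorem stmt13 (d : ℕ)
    (F : (Fin d → ℝ) →ₗ[ℝ] (Fin d → ℝ)) (hF : IsSkew d F) :
    ((∀ x ∈ LinearMap.ker F, (∀ y ∈ LinearMap.ker F, mink d x y = 0) → x = 0) ↔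
      Module.finrank ℝ (LinearMap.range F)
        = d - (LinearMap.charpoly F).rootMultiplicity 0) ∧
    ((∃ w ∈ LinearMap.ker F, w ≠ 0 ∧ ∀ u ∈ LinearMap.ker F, mink d w u = 0) ↔
      (2 < (LinearMap.charpoly F).rootMultiplicity 0 ∧
        Module.finrank ℝ (LinearMap.range F)
          = d - (LinearMap.charpoly F).rootMultiplicity 0 + 2)) := by
  have hrank := finrank_range_add_finrank_ker F
  rw [finrank_fin_fun] at hrank
  by_cases h : ∀ x ∈ ker F, (∀ y ∈ ker F, mink d x y = 0) → x = 0
  · have hm := hF.rootMultiplicity_of_nondegenerate h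
    have hdeg : ¬ ∃ w ∈ ker F, w ≠ 0 ∧ ∀ u ∈ ker F, mink d w u = 0 :=
      fun ⟨w, hw, hw0, hwo⟩ => hw0 (h w hw hwo)
    exact ⟨iff_of_true h (by lia), iff_of_false hdeg (by lia)⟩
  · have hdeg : ∃ w ∈ ker F, w ≠ 0 ∧ ∀ u ∈ ker F, mink d w u = 0 := by
      push Not at h
      obtain ⟨w, hw, hwo, hw0⟩ := h
      exact ⟨w, hw, hw0, hwo⟩
    obtain ⟨w, hw, hw0, hwo⟩ := hdeg
    have hm := hF.rootMultiplicity_of_degenerate hw hw0 hwo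
    have hmd : F.charpoly.rootMultiplicity 0 ≤ d := by
      rw [← finrank_maxGenEigenspace_eq]
      exact (Submodule.finrank_le _).trans_eq (finrank_fin_fun ℝ)
    have hpos : 0 < finrank ℝ (ker F) :=
      finrank_pos_iff_exists_ne_zero.mpr ⟨⟨w, hw⟩, fun h => hw0 (congrArg Subtype.val h)⟩
    exact ⟨iff_of_false h (by lia), iff_of_true ⟨w, hw, hw0, hwo⟩ (by lia)⟩
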